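/- For all positive integers d and m, one has w_p(m·d) ≥ m·w_p(d) and w_s(m·d) ≥ m·w_s(d) (as elements of [0,∞]). -/

import Mathlib

open Set ENNReal

/-- The lattice width of a set `K ⊆ ℝ^ι` with respect to the integer lattice `ℤ^ι`. -/
noncomputable def latticeWidth {ι : Type*} (K : Set (ι → ℝ)) : ℝ :=
  sInf { w : ℝ | ∃ f : (ι → ℝ) →ₗ[ℝ] ℝ,
    (∀ v : ι → ℤ, ∃ k : ℤ, f (fun i => (v i : ℝ)) = (k : ℝ)) ∧ f ≠ 0 ∧
    w = sSup (f '' K) - sInf (f '' K) }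


/-- `w_p(n)`: the supremum in `[0,∞]` of the lattice widths of all hollow lattice
`n`-polytopes. -/
noncomputable def wp (n : ℕ) : ℝ≥0∞ :=
  ⨆ (V : Finset (Fin n → ℝ)) (_ : ∀ v ∈ V, ∀ i, ∃ k : ℤ, v i = (k : ℝ))
    (_ : (interior (convexHull ℝ (V : Set (Fin n → ℝ)))).Nonempty)
    (_ : ∀ z : Fin n → ℤ,
      (fun i => (z i : ℝ)) ∉ interior (convexHull ℝ (V : Set (Fin n → ℝ)))),
    ENNReal.ofReal (latticeWidth (convexHull ℝ (V : Set (Fin n → ℝ))))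

/-- `w_s(n)`: the supremum in `[0,∞]` of the lattice widths of all hollow lattice
`n`-simplices. -/
noncomputable def ws (n : ℕ) : ℝ≥0∞ :=
  ⨆ (v : Fin (n + 1) → (Fin n → ℝ)) (_ : AffineIndependent ℝ v)
    (_ : ∀ j i, ∃ k : ℤ, v j i = (k : ℝ))
    (_ : ∀ z : Fin n → ℤ,
      (fun i => (z i : ℝ)) ∉ interior (convexHull ℝ (Set.range v))),
    ENNReal.ofReal (latticeWidth (convexHull ℝ (Set.range v)))

section BlockSum

variable {ι κ ν : Type*}

/-- Projection of `ℝ^ν ≅ (ℝ^ι)^κ` to the `i`-th block. -/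
def blockProj (e : κ × ι ≃ ν) (i : κ) : (ν → ℝ) →ₗ[ℝ] (ι → ℝ) :=
  LinearMap.funLeft ℝ ℝ fun k => e (i, k)

/-- Inclusion of the `i`-th block into `ℝ^ν ≅ (ℝ^ι)^κ`. -/
def blockIncl [DecidableEq κ] (e : κ × ι ≃ ν) (i : κ) : (ι → ℝ) →ₗ[ℝ] (ν → ℝ) where
  toFun x j := if (e.symm j).1 = i then x (e.symm j).2 else 0
  map_add' x y := by
    ext j
    by_cases h : (e.symm j).1 = i <;> simp [h]
  map_smul' c x := by
    ext j
    by_cases h : (e.symm j).1 = i <;> simp [h]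

@[simp]
lemma blockProj_apply (e : κ × ι ≃ ν) (i : κ) (x : ν → ℝ) (k : ι) :
    blockProj e i x k = x (e (i, k)) := rfl

lemma notMem_interior_of_forall_le [Fintype ν] {S : Set (ν → ℝ)} {g : (ν → ℝ) →ₗ[ℝ] ℝ}
    (hg : g ≠ 0) {z : ν → ℝ} (h : ∀ x ∈ S, g x ≤ g z) : z ∉ interior (convexHull ℝ S) := by
  intro hz
  have hsub : convexHull ℝ S ⊆ {x | g x ≤ g z} :=
    convexHull_min h (convex_halfSpace_le g.isLinear _)
  have hmax : IsLocalMax g.toContinuousLinearMap z :=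
    Filter.mem_of_superset (mem_interior_iff_mem_nhds.1 hz) hsub
  have h0 := hmax.hasFDerivAt_eq_zero g.toContinuousLinearMap.hasFDerivAt
  exact hg (LinearMap.ext fun x => congrArg (fun f : (ν → ℝ) →L[ℝ] ℝ => f x) h0)

variable [DecidableEq κ]

lemma blockIncl_apply (e : κ × ι ≃ ν) (i : κ) (x : ι → ℝ) (j : ν) :
    blockIncl e i x j = if (e.symm j).1 = i then x (e.symm j).2 else 0 := rfl

lemma blockProj_blockIncl_self (e : κ × ι ≃ ν) (i : κ) (x : ι → ℝ) :
    blockProj e i (blockIncl e i x) = x := by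
  ext k
  simp [blockIncl_apply]

lemma blockProj_blockIncl_of_ne (e : κ × ι ≃ ν) {i j : κ} (h : i ≠ j) (x : ι → ℝ) :
    blockProj e i (blockIncl e j x) = 0 := by
  ext k
  simp [blockIncl_apply, h]

lemma sum_blockIncl_blockProj [Fintype κ] (e : κ × ι ≃ ν) (x : ν → ℝ) :
    ∑ i, blockIncl e i (blockProj e i x) = x := by
  ext j
  simp [blockIncl_apply]

/-- The direct sum of `|κ|` copies of `A - v₀`, each dilated by the factor `|κ|`. -/
def blockSum [Fintype κ] (e : κ × ι ≃ ν) (v₀ : ι → ℝ) (A : Set (ι → ℝ)) : Set (ν → ℝ) :=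
  ⋃ i, (fun a => (Fintype.card κ : ℝ) • blockIncl e i (a - v₀)) '' A

variable [Fintype κ]

lemma finite_blockSum (e : κ × ι ≃ ν) (v₀ : ι → ℝ) {A : Set (ι → ℝ)} (hA : A.Finite) :
    (blockSum e v₀ A).Finite :=
  Set.finite_iUnion fun _ => hA.image _

lemma blockSum_integral (e : κ × ι ≃ ν) {v₀ : ι → ℝ} {A : Set (ι → ℝ)}
    (hv₀ : ∀ i, ∃ k : ℤ, v₀ i = k) (hA : ∀ v ∈ A, ∀ i, ∃ k : ℤ, v i = k) :
    ∀ v ∈ blockSum e v₀ A, ∀ i, ∃ k : ℤ, v i = k := by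
  intro v hv j
  simp only [blockSum, mem_iUnion, mem_image] at hv
  obtain ⟨i, a, ha, rfl⟩ := hv
  obtain ⟨p, hp⟩ := hA a ha (e.symm j).2
  obtain ⟨q, hq⟩ := hv₀ (e.symm j).2
  by_cases h : (e.symm j).1 = i
  · exact ⟨Fintype.card κ * (p - q), by simp [blockIncl_apply, h, hp, hq]⟩
  · exact ⟨0, by simp [blockIncl_apply, h]⟩

lemma smul_blockIncl_mem_convexHull_blockSum (e : κ × ι ≃ ν) (v₀ : ι → ℝ) {A : Set (ι → ℝ)}
    (i : κ) {a : ι → ℝ} (ha : a ∈ convexHull ℝ A) :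
    (Fintype.card κ : ℝ) • blockIncl e i (a - v₀) ∈ convexHull ℝ (blockSum e v₀ A) := by
  let φ : (ι → ℝ) →ᵃ[ℝ] (ν → ℝ) :=
    ((Fintype.card κ : ℝ) • blockIncl e i).toAffineMap.comp
      (AffineMap.id ℝ (ι → ℝ) - AffineMap.const ℝ (ι → ℝ) v₀)
  have hφ : φ a ∈ convexHull ℝ (φ '' A) := by
    rw [← φ.image_convexHull]
    exact mem_image_of_mem _ ha
  exact convexHull_mono (subset_iUnion
    (fun i => (fun a => (Fintype.card κ : ℝ) • blockIncl e i (a - v₀)) '' A) i) hφ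

lemma mem_convexHull_blockSum [Nonempty κ] (e : κ × ι ≃ ν) (v₀ : ι → ℝ) {A : Set (ι → ℝ)}
    {x : ν → ℝ} (hx : ∀ i, blockProj e i x + v₀ ∈ convexHull ℝ A) :
    x ∈ convexHull ℝ (blockSum e v₀ A) := by
  have hc : (Fintype.card κ : ℝ) ≠ 0 := by simp
  have h := (convex_convexHull ℝ (blockSum e v₀ A)).sum_mem (t := Finset.univ)
    (w := fun _ : κ => (Fintype.card κ : ℝ)⁻¹) (fun _ _ => by positivity) (by simp)
    (fun i _ => smul_blockIncl_mem_convexHull_blockSum e v₀ i (hx i))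
  simpa [smul_smul, hc, sum_blockIncl_blockProj] using h

lemma interior_convexHull_blockSum_nonempty [Nonempty κ] (e : κ × ι ≃ ν) (v₀ : ι → ℝ)
    {A : Set (ι → ℝ)} (hA : (interior (convexHull ℝ A)).Nonempty) :
    (interior (convexHull ℝ (blockSum e v₀ A))).Nonempty := by
  obtain ⟨a, ha⟩ := hA
  have hcont : ∀ i, Continuous fun x : ν → ℝ => blockProj e i x + v₀ := fun i =>
    (continuous_pi fun k => continuous_apply (e (i, k))).add continuous_const
  let U : Set (ν → ℝ) := ⋂ i, (fun x => blockProj e i x + v₀) ⁻¹' interior (convexHull ℝ A)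
  have hU : IsOpen U := isOpen_iInter_of_finite fun i => isOpen_interior.preimage (hcont i)
  have hsub : U ⊆ convexHull ℝ (blockSum e v₀ A) := fun x hx =>
    mem_convexHull_blockSum e v₀ fun i => interior_subset (mem_iInter.1 hx i)
  refine ⟨fun j => (a - v₀) (e.symm j).2, interior_maximal hsub hU (mem_iInter.2 fun i => ?_)⟩
  have h : blockProj e i (fun j => (a - v₀) (e.symm j).2) + v₀ = a := by
    ext k
    simp
  simpa only [mem_preimage, h] using ha

lemma exists_blockProj_add_mem_interior [Fintype ι] [Fintype ν] [Nonempty κ] (e : κ × ι ≃ ν)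
    {v₀ : ι → ℝ} {A : Set (ι → ℝ)} (hv₀ : v₀ ∈ A) (hA : (interior (convexHull ℝ A)).Nonempty)
    {z : ν → ℝ} (hz : z ∈ interior (convexHull ℝ (blockSum e v₀ A))) :
    ∃ i, blockProj e i z + v₀ ∈ interior (convexHull ℝ A) := by
  by_contra! hcon
  have hsep : ∀ i, ∃ f : (ι → ℝ) →ₗ[ℝ] ℝ, f ≠ 0 ∧ ∀ a ∈ A, f (a - v₀) ≤ f (blockProj e i z) := by
    intro i
    obtain ⟨f, hf⟩ := geometric_hahn_banach_open_point
      (convex_convexHull ℝ A).interior isOpen_interior (hcon i)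
    refine ⟨f.toLinearMap, ?_, fun a ha => ?_⟩
    · intro h0
      obtain ⟨a, ha⟩ := hA
      have h0' : ∀ x, f x = 0 := fun x => LinearMap.congr_fun h0 x
      simpa [h0'] using hf a ha
    · have hcl : a ∈ closure (interior (convexHull ℝ A)) := by
        rw [(convex_convexHull ℝ A).closure_interior_eq_closure_of_nonempty_interior hA]
        exact subset_closure (subset_convexHull ℝ A ha)
      have hle : f a ≤ f (blockProj e i z + v₀) :=
        closure_minimal (fun b hb => (hf b hb).le)
          (isClosed_le f.continuous continuous_const) hcl
      simp only [map_add] at hle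
      simp only [ContinuousLinearMap.coe_coe, map_sub]
      linarith
  choose f hf0 hf using hsep
  have hpos : ∀ i, 0 ≤ f i (blockProj e i z) := fun i => by simpa using hf i v₀ hv₀
  have hcard : (0 : ℝ) < Fintype.card κ := by exact_mod_cast Fintype.card_pos
  by_cases hzero : ∃ i, f i (blockProj e i z) = 0
  · obtain ⟨i, hi⟩ := hzero
    refine notMem_interior_of_forall_le (g := f i ∘ₗ blockProj e i) ?_ ?_ hz
    · intro h
      refine hf0 i (LinearMap.ext fun x => ?_)
      simpa [blockProj_blockIncl_self] using LinearMap.congr_fun h (blockIncl e i x)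
    · intro x hx
      simp only [blockSum, mem_iUnion, mem_image] at hx
      obtain ⟨j, a, ha, rfl⟩ := hx
      rw [LinearMap.comp_apply, LinearMap.comp_apply, hi, map_smul, map_smul, smul_eq_mul]
      by_cases hij : i = j
      · subst hij
        rw [blockProj_blockIncl_self]
        exact mul_nonpos_of_nonneg_of_nonpos hcard.le (hi ▸ hf i a ha)
      · simp [blockProj_blockIncl_of_ne e hij]
  · push Not at hzero
    have hp : ∀ i, 0 < f i (blockProj e i z) := fun i => (hpos i).lt_of_ne' (hzero i)
    let g : (ν → ℝ) →ₗ[ℝ] ℝ := ∑ i, (f i (blockProj e i z))⁻¹ • (f i ∘ₗ blockProj e i)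
    have hgz : g z = Fintype.card κ := by
      simp [g, LinearMap.sum_apply, inv_mul_cancel₀ (hzero _)]
    refine notMem_interior_of_forall_le (g := g) ?_ ?_ hz
    · intro h
      rw [h, LinearMap.zero_apply] at hgz
      exact hcard.ne hgz
    · intro x hx
      simp only [blockSum, mem_iUnion, mem_image] at hx
      obtain ⟨j, a, ha, rfl⟩ := hx
      have hgE : g (blockIncl e j (a - v₀)) = (f j (blockProj e j z))⁻¹ * f j (a - v₀) := by
        simp only [g, LinearMap.sum_apply, LinearMap.smul_apply, LinearMap.comp_apply, smul_eq_mul]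
        rw [Finset.sum_eq_single j, blockProj_blockIncl_self]
        · intro i _ hij
          simp [blockProj_blockIncl_of_ne e hij]
        · simp
      rw [hgz, map_smul, hgE, smul_eq_mul]
      refine mul_le_of_le_one_right hcard.le ?_
      rw [inv_mul_le_one₀ (hp j)]
      exact hf j a ha

lemma hollow_blockSum [Fintype ι] [Fintype ν] [Nonempty κ] (e : κ × ι ≃ ν)
    {v₀ : ι → ℝ} {A : Set (ι → ℝ)} (hv₀ : v₀ ∈ A) (hv₀' : ∀ i, ∃ k : ℤ, v₀ i = k)
    (hA : (interior (convexHull ℝ A)).Nonempty)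
    (hollow : ∀ z : ι → ℤ, (fun i => (z i : ℝ)) ∉ interior (convexHull ℝ A)) (z : ν → ℤ) :
    (fun i => (z i : ℝ)) ∉ interior (convexHull ℝ (blockSum e v₀ A)) := by
  intro hz
  obtain ⟨i, hi⟩ := exists_blockProj_add_mem_interior e hv₀ hA hz
  choose q hq using hv₀'
  refine hollow (fun k => z (e (i, k)) + q k) ?_
  convert hi using 1
  ext k
  simp [hq]

lemma card_mul_latticeWidth_le [Fintype ι] [Fintype ν] [Nonempty ν] (e : κ × ι ≃ ν)
    (v₀ : ι → ℝ) {A : Set (ι → ℝ)} (hA : A.Finite) (hne : A.Nonempty) :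
    Fintype.card κ * latticeWidth (convexHull ℝ A) ≤
      latticeWidth (convexHull ℝ (blockSum e v₀ A)) := by
  have hKne : (convexHull ℝ A).Nonempty := hne.convexHull
  have hK : ∀ f : (ι → ℝ) →ₗ[ℝ] ℝ, IsCompact (f '' convexHull ℝ A) := fun f =>
    (hA.isCompact_convexHull ℝ).image f.continuous_of_finiteDimensional
  refine le_csInf ?_ ?_
  · classical
    inhabit ν
    refine ⟨_, LinearMap.proj default, fun v => ⟨v default, rfl⟩, fun h => ?_, rfl⟩
    simpa using LinearMap.congr_fun h (fun _ => (1 : ℝ))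
  rintro _ ⟨f, hfint, hf0, rfl⟩
  obtain ⟨i, hi⟩ : ∃ i, f ∘ₗ blockIncl e i ≠ 0 := by
    by_contra! h
    refine hf0 (LinearMap.ext fun x => ?_)
    rw [← sum_blockIncl_blockProj e x, map_sum]
    exact Finset.sum_eq_zero fun i _ => LinearMap.congr_fun (h i) _
  set g := f ∘ₗ blockIncl e i with hg
  have hle : latticeWidth (convexHull ℝ A) ≤
      sSup (g '' convexHull ℝ A) - sInf (g '' convexHull ℝ A) := by
    refine csInf_le ⟨0, ?_⟩ ⟨g, fun v => ?_, hi, rfl⟩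
    · rintro _ ⟨f, -, -, rfl⟩
      exact sub_nonneg.2 (csInf_le_csSup (hKne.image _) (hK f).bddBelow (hK f).bddAbove)
    · obtain ⟨k, hk⟩ := hfint fun j => if (e.symm j).1 = i then v (e.symm j).2 else 0
      refine ⟨k, hk ▸ congrArg f (funext fun j => ?_)⟩
      simp [blockIncl_apply]
  have hD : IsCompact (f '' convexHull ℝ (blockSum e v₀ A)) :=
    ((finite_blockSum e v₀ hA).isCompact_convexHull ℝ).image
      f.continuous_of_finiteDimensional
  obtain ⟨a, ha, hga⟩ := (hK g).sSup_mem (hKne.image _)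
  obtain ⟨b, hb, hgb⟩ := (hK g).sInf_mem (hKne.image _)
  have h1 := le_csSup hD.bddAbove
    (mem_image_of_mem f (smul_blockIncl_mem_convexHull_blockSum e v₀ i ha))
  have h2 := csInf_le hD.bddBelow
    (mem_image_of_mem f (smul_blockIncl_mem_convexHull_blockSum e v₀ i hb))
  have hfg : ∀ x, f ((Fintype.card κ : ℝ) • blockIncl e i (x - v₀)) =
      Fintype.card κ * (g x - g v₀) := fun x => by
    simp [hg]
  rw [hfg] at h1 h2
  have h3 := mul_le_mul_of_nonneg_left hle (Nat.cast_nonneg (α := ℝ) (Fintype.card κ))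
  rw [← hga, ← hgb] at h3
  linarith

end BlockSum

lemma interior_convexHull_range_nonempty {d : ℕ} {v : Fin (d + 1) → (Fin d → ℝ)}
    (hv : AffineIndependent ℝ v) : (interior (convexHull ℝ (range v))).Nonempty := by
  rw [interior_convexHull_nonempty_iff_affineSpan_eq_top,
    hv.affineSpan_eq_top_iff_card_eq_finrank_add_one]
  simp

lemma affineIndependent_of_interior_nonempty {d : ℕ} {v : Fin (d + 1) → (Fin d → ℝ)}
    (hv : (interior (convexHull ℝ (range v))).Nonempty) : AffineIndependent ℝ v := by
  rw [interior_convexHull_nonempty_iff_affineSpan_eq_top] at hv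
  rw [affineIndependent_iff_finrank_vectorSpan_eq ℝ v (Fintype.card_fin _),
    AffineSubspace.vectorSpan_eq_top_of_affineSpan_eq_top _ _ _ hv]
  simp

/-- The vertices of the direct sum of `m` copies of a simplex, based at its zeroth vertex. -/
def simplexBlockSum {d : ℕ} (m : ℕ) (v : Fin (d + 1) → (Fin d → ℝ)) :
    Fin (m * d + 1) → (Fin (m * d) → ℝ) :=
  Fin.cons 0 fun j => (m : ℝ) • blockIncl finProdFinEquiv (finProdFinEquiv.symm j).1
    (v (finProdFinEquiv.symm j).2.succ - v 0)

lemma range_simplexBlockSum {d m : ℕ} (hm : 0 < m) (v : Fin (d + 1) → (Fin d → ℝ)) :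
    range (simplexBlockSum m v) = blockSum (finProdFinEquiv (m := m)) (v 0) (range v) := by
  ext x
  simp only [blockSum, simplexBlockSum, Fin.range_cons, mem_insert_iff, mem_range, mem_iUnion,
    mem_image, exists_exists_eq_and, Fintype.card_fin]
  constructor
  · rintro (rfl | ⟨j, rfl⟩)
    · exact ⟨⟨0, hm⟩, 0, by simp⟩
    · exact ⟨_, _, rfl⟩
  · rintro ⟨i, k, rfl⟩
    induction k using Fin.cases with
    | zero => simp
    | succ k => exact Or.inr ⟨finProdFinEquiv (i, k), by simp⟩

theorem wp_ws_mul_superadditive (d m : ℕ) (hd : 0 < d) (hm : 0 < m) :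
    (m : ℝ≥0∞) * wp d ≤ wp (m * d) ∧ (m : ℝ≥0∞) * ws d ≤ ws (m * d) := by
  have : Nonempty (Fin m) := ⟨⟨0, hm⟩⟩
  have : Nonempty (Fin (m * d)) := ⟨⟨0, Nat.mul_pos hm hd⟩⟩
  let e : Fin m × Fin d ≃ Fin (m * d) := finProdFinEquiv
  have hwidth : ∀ (v₀ : Fin d → ℝ) {A : Set (Fin d → ℝ)}, A.Finite → A.Nonempty →
      (m : ℝ≥0∞) * ENNReal.ofReal (latticeWidth (convexHull ℝ A)) ≤
        ENNReal.ofReal (latticeWidth (convexHull ℝ (blockSum e v₀ A))) := by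
    intro v₀ A hA hne
    rw [← ENNReal.ofReal_natCast m, ← ENNReal.ofReal_mul (Nat.cast_nonneg m)]
    simpa using ENNReal.ofReal_le_ofReal (card_mul_latticeWidth_le e v₀ hA hne)
  constructor
  · simp only [wp, ENNReal.mul_iSup]
    refine iSup_le fun V => iSup_le fun hV => iSup_le fun hne => iSup_le fun hollow => ?_
    obtain ⟨v₀, hv₀⟩ : (V : Set (Fin d → ℝ)).Nonempty :=
      convexHull_nonempty_iff.1 (hne.mono interior_subset)
    obtain ⟨W, hW⟩ := (finite_blockSum e v₀ V.finite_toSet).exists_finset_coe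
    refine le_iSup_of_le W (le_iSup_of_le ?_ (le_iSup_of_le ?_ (le_iSup_of_le ?_ ?_)))
    · intro w hw
      exact blockSum_integral e (hV v₀ hv₀) hV w (hW ▸ hw)
    · rw [hW]
      exact interior_convexHull_blockSum_nonempty e v₀ hne
    · rw [hW]
      exact hollow_blockSum e hv₀ (hV v₀ hv₀) hne hollow
    · rw [hW]
      exact hwidth v₀ V.finite_toSet ⟨v₀, hv₀⟩
  · simp only [ws, ENNReal.mul_iSup]
    refine iSup_le fun v => iSup_le fun hv => iSup_le fun hv_int => iSup_le fun hollow => ?_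
    have hne := interior_convexHull_range_nonempty hv
    have hr : range (simplexBlockSum m v) = blockSum e (v 0) (range v) :=
      range_simplexBlockSum hm v
    refine le_iSup_of_le (simplexBlockSum m v)
      (le_iSup_of_le ?_ (le_iSup_of_le ?_ (le_iSup_of_le ?_ ?_)))
    · apply affineIndependent_of_interior_nonempty
      rw [hr]
      exact interior_convexHull_blockSum_nonempty e (v 0) hne
    · intro j
      exact blockSum_integral e (hv_int 0) (forall_mem_range.2 hv_int) _ (hr ▸ mem_range_self j)
    · rw [hr]
      exact hollow_blockSum e (mem_range_self 0) (hv_int 0) hne hollow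
    · rw [hr]
      exact hwidth (v 0) (finite_range v) (range_nonempty v)
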